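/- The monoid M = Mon⟨a,b : a b² a² b² = b⟩ is not residually finite: there exist two distinct elements u ≠ v of M such that for every finite monoid F and every monoid homomorphism ψ : M → F, one has ψ(u) = ψ(v). -/

import Mathlib

open Relation FreeMonoid

/-- Words over the alphabet `A`: the free monoid on `A`. -/
abbrev Word (A : Type) : Type := FreeMonoid A

/-- One-step rewriting relation of the rewriting system `R`. -/
def OneStep {A : Type} (R : Set (Word A × Word A)) (x y : Word A) : Prop :=
  ∃ u v l r : Word A, (l, r) ∈ R ∧ x = u * l * v ∧ y = u * r * v

/-- Confluence of the rewriting system `R`. -/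
def IsConfluent {A : Type} (R : Set (Word A × Word A)) : Prop :=
  ∀ w x y : Word A, ReflTransGen (OneStep R) w x → ReflTransGen (OneStep R) w y →
    ∃ z : Word A, ReflTransGen (OneStep R) x z ∧ ReflTransGen (OneStep R) y z

/-- Termination of the rewriting system `R`: no infinite rewriting chain. -/
def IsTerminating {A : Type} (R : Set (Word A × Word A)) : Prop :=
  ¬ ∃ f : ℕ → Word A, ∀ n : ℕ, OneStep R (f n) (f (n + 1))

/-- The monoid presented by generators `A` and relations `R`: the quotient of the
free monoid on `A` by the congruence generated by `R`. -/
abbrev MonPres {A : Type} (R : Set (Word A × Word A)) : Type :=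
  (conGen fun x y : Word A => (x, y) ∈ R).Quotient

/-- The canonical projection from words to the presented monoid. -/
def presMk {A : Type} (R : Set (Word A × Word A)) : Word A →* MonPres R :=
  Con.mk' _

/-- A two-letter alphabet. -/
inductive AB : Type | a | b

/-- A three-letter alphabet. -/
inductive ABX : Type | a | b | x


/-- The defining relation of `M = Mon⟨a,b : a b² a² b² = b⟩`. -/
def rel0 : Set (Word AB × Word AB) :=
  {((of AB.a) * (of AB.b)^2 * (of AB.a)^2 * (of AB.b)^2, of AB.b)}

/-- The element of `M` represented by the generator `a`. -/
def A0 : MonPres rel0 := presMk _ (of AB.a)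

/-- The element of `M` represented by the generator `b`. -/
def B0 : MonPres rel0 := presMk _ (of AB.b)

/-- In a finite monoid every solution of `p * b ^ 2 = b` satisfies `b * b ^ (m + 1) = b`
for some `m`. -/
theorem exists_mul_pow_succ_eq_self {F : Type*} [Monoid F] [Finite F] {p b : F}
    (h : p * b ^ 2 = b) : ∃ m : ℕ, b * b ^ (m + 1) = b := by
  have hp : ∀ n : ℕ, p ^ n * b ^ (n + 1) = b := by
    intro n
    induction n with
    | zero => simp
    | succ n ih =>
      calc p ^ (n + 1) * b ^ (n + 1 + 1) = p ^ n * ((p * b ^ 2) * b ^ n) := by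
            rw [pow_succ p, show n + 1 + 1 = 2 + n by omega, pow_add b 2 n]
            simp only [mul_assoc]
        _ = b := by rw [h, ← pow_succ', ih]
  obtain ⟨i, j, hlt, hij⟩ : ∃ i j : ℕ, i < j ∧ b ^ i = b ^ j := by
    obtain ⟨i, j, hne, hij⟩ := Finite.exists_ne_map_eq_of_infinite fun n : ℕ => b ^ n
    rcases lt_or_gt_of_ne hne with hlt | hlt
    · exact ⟨i, j, hlt, hij⟩
    · exact ⟨j, i, hlt, hij.symm⟩
  obtain ⟨m, rfl⟩ := Nat.exists_eq_add_of_lt hlt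
  refine ⟨m, ?_⟩
  calc b * b ^ (m + 1) = p ^ i * b ^ (i + 1) * b ^ (m + 1) := by rw [hp]
    _ = p ^ i * (b ^ (i + m + 1) * b) := by
      rw [mul_assoc, ← pow_add, ← pow_succ]
      congr 2
      omega
    _ = b := by rw [← hij, ← pow_succ, hp]

/-- The relation `a b² a² b² = b` forces `b a b² a² b = b` in finite monoids. -/
theorem mul_eq_self_of_finite {F : Type*} [Monoid F] [Finite F] {a b : F}
    (h : a * b ^ 2 * a ^ 2 * b ^ 2 = b) : b * (a * b ^ 2 * a ^ 2 * b) = b := by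
  obtain ⟨m, hm⟩ := exists_mul_pow_succ_eq_self h
  have he : a * b ^ 2 * a ^ 2 * b = b ^ (m + 1) := by
    calc a * b ^ 2 * a ^ 2 * b = a * b ^ 2 * a ^ 2 * (b * b ^ (m + 1)) := by rw [hm]
      _ = a * b ^ 2 * a ^ 2 * b ^ 2 * b ^ m := by
        rw [pow_succ' b m, ← mul_assoc b b, ← sq, ← mul_assoc]
      _ = b ^ (m + 1) := by rw [h, pow_succ']
  rw [he, hm]

/-- With `AB.b` standing for the element `c = a b²` of `M`, the normal form of `a c w` with
respect to the complete rewriting system `acaccac → c`, `acaccc → caccac`. -/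
def prependAC : List AB → List AB
  | .a :: .b :: .b :: .a :: .b :: w => .b :: w
  | .a :: .b :: .b :: .b :: w => .b :: .a :: .b :: .b :: prependAC w
  | w => .a :: .b :: w

/-- The normal form of `a w`, where `AB.b` stands for `c = a b²`. -/
def prependA : List AB → List AB
  | .b :: w => prependAC w
  | w => .a :: w

/-- Words in `a` and `c` that are irreducible for `acaccac → c`, `acaccc → caccac`. -/
def IsNormal : List AB → Prop
  | [] => True
  | .b :: w => IsNormal w
  | .a :: w => IsNormal w ∧ prependA w = .a :: w

theorem isNormal_prependAC (w : List AB) (hw : IsNormal w) : IsNormal (prependAC w) := by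
  induction w using prependAC.induct with
  | case1 w => simp_all [IsNormal, prependAC]
  | case2 w ih => simp_all [IsNormal, prependAC, prependA]
  | case3 w h₁ h₂ =>
    have hx : prependAC w = .a :: .b :: w := by rw [prependAC] <;> assumption
    rw [hx]
    exact ⟨hw, hx⟩

theorem isNormal_prependA (w : List AB) (hw : IsNormal w) : IsNormal (prependA w) := by
  match w with
  | [] => simp [IsNormal, prependA]
  | .b :: w => exact isNormal_prependAC w hw
  | .a :: w => exact ⟨hw, rfl⟩

theorem prependAC_prependAC (w : List AB) (hw : IsNormal w) :
    prependAC (.a :: .b :: .b :: prependAC w) = .b :: w := by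
  induction w using prependAC.induct with
  | case1 w =>
    have hx : prependAC w = .a :: .b :: w := by simp_all [IsNormal, prependA]
    simp [prependAC, hx]
  | case2 w ih => simp_all [IsNormal, prependAC]
  | case3 w h₁ h₂ =>
    have hx : prependAC w = .a :: .b :: w := by rw [prependAC] <;> assumption
    simp [hx, prependAC]

/-- Left multiplication by `a` on normal forms. -/
def actA : Function.End {w : List AB // IsNormal w} :=
  fun w => ⟨prependA w.1, isNormal_prependA w.1 w.2⟩

/-- Left multiplication by `c = a b²` on normal forms. -/
def actC : Function.End {w : List AB // IsNormal w} :=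
  fun w => ⟨.b :: w.1, w.2⟩

/-- The action of words on normal forms; `b` acts as `c a c`. -/
def actWord : Word AB →* Function.End {w : List AB // IsNormal w} :=
  FreeMonoid.lift fun
    | .a => actA
    | .b => actC * actA * actC

theorem actA_mul_sq : actA * (actC * actA * actC) ^ 2 = actC := by
  funext w
  exact Subtype.ext (prependAC_prependAC w.1 w.2)

/-- The action of `M` on normal forms. -/
def actPres : MonPres rel0 →* Function.End {w : List AB // IsNormal w} :=
  Con.lift _ actWord <| Con.conGen_le.2 <| by
    rintro x y h
    obtain ⟨rfl, rfl⟩ := Prod.mk.inj (Set.mem_singleton_iff.1 h)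
    change actWord _ = actWord _
    simp only [actWord, map_mul, map_pow, FreeMonoid.lift_eval_of]
    rw [actA_mul_sq, sq actA, mul_assoc, mul_assoc actA, actA_mul_sq, ← mul_assoc]

theorem actPres_A0 : actPres A0 = actA := rfl

theorem actPres_B0 : actPres B0 = actC * actA * actC := rfl

theorem A0_mul_eq_B0 : A0 * B0 ^ 2 * A0 ^ 2 * B0 ^ 2 = B0 :=
  (Con.eq _).2 (ConGen.Rel.of _ _ rfl)

/-- `M = Mon⟨a,b : a b² a² b² = b⟩` is not residually finite. -/
theorem stmt18 :
    ∃ u v : MonPres rel0, u ≠ v ∧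
      ∀ (F : Type) (_ : Monoid F) (_ : Finite F) (ψ : MonPres rel0 →* F), ψ u = ψ v := by
  refine ⟨B0 * (A0 * B0 ^ 2 * A0 ^ 2 * B0), B0, fun h => ?_, fun F _ _ ψ => ?_⟩
  · have h' := congrArg (fun x => (actPres x ⟨[], trivial⟩).1) h
    simp only [map_mul, map_pow, actPres_A0, actPres_B0, actA_mul_sq] at h'
    have h₂ : ([.b, .a, .b, .b, .a, .a, .b, .a, .b] : List AB) = [.b, .a, .b] := h'
    simp at h₂
  · have h := congrArg ψ A0_mul_eq_B0
    simp only [map_mul, map_pow] at h ⊢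
    exact mul_eq_self_of_finite h
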